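/- Let n > m ≥ 1 be integers and let s > m. Let Λ be a compact metric space, ω a finite nonzero Borel measure on Λ, and (P_λ)_{λ∈Λ} a family of orthogonal projections from ℝⁿ onto ℝᵐ such that λ ↦ P_λ x is continuous for every x ∈ ℝⁿ. Suppose that for every μ ∈ M(Bⁿ(0,1)) satisfying μ(B(x,r)) ≤ r^s for all x ∈ ℝⁿ and r > 0, the push-forward P_{λ♯}μ is absolutely continuous with respect to Lebesgue measure L^m for ω-almost all λ ∈ Λ, and that there is a constant C > 0 (independent of μ) such that ∫_Λ ∫_{ℝᵐ} D(P_{λ♯}μ, u)² dL^m(u) dω(λ) < C for all such μ. If A ⊂ ℝⁿ is H^s-measurable with 0 < H^s(A) < ∞ and the lower density θ^s_*(A,x) > 0 for H^s-almost all x ∈ A, then for ω-almost all λ ∈ Λ the set of u ∈ ℝᵐ for which the Hausdorff dimension of P_λ⁻¹{u} ∩ A equals s − m has positive Lebesgue measure L^m. -/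

import Mathlib

open MeasureTheory Metric Filter
open scoped ENNReal Topology

noncomputable section

/-- `P : ℝⁿ → ℝᵐ` is an orthogonal projection: a surjective linear map whose restriction to
the orthogonal complement of its kernel is an isometry. -/
def IsOrthoProj {E F : Type*} [NormedAddCommGroup E] [InnerProductSpace ℝ E]
    [NormedAddCommGroup F] [InnerProductSpace ℝ F] (P : E →ₗ[ℝ] F) : Prop :=
  Function.Surjective P ∧ ∀ x ∈ (LinearMap.ker P)ᗮ, ‖P x‖ = ‖x‖

/-- The derivative `D(ν,u) = lim_{δ→0} α(m)⁻¹ δ^{-m} ν(B(u,δ))` of a measure `ν` on `ℝᵐ`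
(junk value if the limit does not exist). -/
def densD {m : ℕ} (ν : Measure (EuclideanSpace ℝ (Fin m))) (u : EuclideanSpace ℝ (Fin m)) :
    ℝ≥0∞ :=
  limUnder (𝓝[>] (0 : ℝ)) fun δ : ℝ =>
    ν (closedBall u δ) /
      (volume (closedBall (0 : EuclideanSpace ℝ (Fin m)) 1) * ENNReal.ofReal (δ ^ m))

/-- The lower `s`-density `θ^s_*(A,x) = liminf_{r→0} (2r)^{-s} H^s(A ∩ B(x,r))`. -/
def lowerDensity {n : ℕ} (s : ℝ) (A : Set (EuclideanSpace ℝ (Fin n)))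
    (x : EuclideanSpace ℝ (Fin n)) : ℝ≥0∞ :=
  liminf (fun r : ℝ => μH[s] (A ∩ closedBall x r) / ENNReal.ofReal ((2 * r) ^ s)) (𝓝[>] 0)

open scoped NNReal

/-- Index of the dyadic cube of generation `j` containing `x`. -/
def cubeIdx {n : ℕ} (j : ℕ) (x : EuclideanSpace ℝ (Fin n)) : Fin n → ℤ :=
  fun i => ⌊(2 : ℝ) ^ j * x i⌋

lemma measurable_cubeIdx {n : ℕ} (j : ℕ) :
    Measurable (cubeIdx j : EuclideanSpace ℝ (Fin n) → (Fin n → ℤ)) := by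
  refine measurable_pi_lambda _ fun i => ?_
  refine Int.measurable_floor.comp ?_
  have : Continuous fun x : EuclideanSpace ℝ (Fin n) => (2 : ℝ) ^ j * x i := by fun_prop
  exact this.measurable

lemma abs_coord_sub_le {n : ℕ} (x y : EuclideanSpace ℝ (Fin n)) (i : Fin n) :
    |x i - y i| ≤ dist x y := by
  rw [dist_eq_norm]
  have := PiLp.norm_apply_le (x - y) i
  simpa using this

/-- The `3^n` neighbours. -/
def nbrs (n : ℕ) : Finset (Fin n → ℤ) := Fintype.piFinset fun _ => Finset.Icc (-1 : ℤ) 1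

lemma card_nbrs (n : ℕ) : (nbrs n).card = 3 ^ n := by
  simp [nbrs]

lemma cubeIdx_sub_mem {n : ℕ} (j : ℕ) (x y : EuclideanSpace ℝ (Fin n))
    (h : dist x y ≤ (2 : ℝ)⁻¹ ^ j) : cubeIdx j y - cubeIdx j x ∈ nbrs n := by
  simp only [nbrs, Fintype.mem_piFinset, Finset.mem_Icc, Pi.sub_apply, cubeIdx]
  intro i
  have h1 := (abs_coord_sub_le x y i).trans h
  have h2 : |(2 : ℝ) ^ j * x i - 2 ^ j * y i| ≤ 1 := by
    rw [← mul_sub, abs_mul, abs_of_pos (by positivity : (0 : ℝ) < 2 ^ j)]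
    calc (2 : ℝ) ^ j * |x i - y i| ≤ 2 ^ j * (2 : ℝ)⁻¹ ^ j := by gcongr
      _ = 1 := by rw [← mul_pow]; norm_num
  rw [abs_le] at h2
  have a1 := Int.floor_le ((2 : ℝ) ^ j * x i)
  have a2 := Int.lt_floor_add_one ((2 : ℝ) ^ j * x i)
  have b1 := Int.floor_le ((2 : ℝ) ^ j * y i)
  have b2 := Int.lt_floor_add_one ((2 : ℝ) ^ j * y i)
  constructor
  · have : ((⌊(2 : ℝ) ^ j * x i⌋ : ℤ) : ℝ) < ((⌊(2 : ℝ) ^ j * y i⌋ + 2 : ℤ) : ℝ) := by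
      push_cast; linarith
    have := Int.cast_lt.mp this
    omega
  · have : ((⌊(2 : ℝ) ^ j * y i⌋ : ℤ) : ℝ) < ((⌊(2 : ℝ) ^ j * x i⌋ + 2 : ℤ) : ℝ) := by
      push_cast; linarith
    have := Int.cast_lt.mp this
    omega

lemma dist_le_of_cubeIdx_eq {n : ℕ} (j : ℕ) (x y : EuclideanSpace ℝ (Fin n))
    (h : cubeIdx j x = cubeIdx j y) : dist x y ≤ n * (2 : ℝ)⁻¹ ^ j := by
  have hc : ∀ i, |x i - y i| ≤ (2 : ℝ)⁻¹ ^ j := by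
    intro i
    have h1 := congrFun h i
    simp only [cubeIdx] at h1
    have h2 := Int.abs_sub_lt_one_of_floor_eq_floor h1
    rw [← mul_sub, abs_mul, abs_of_pos (by positivity : (0 : ℝ) < 2 ^ j)] at h2
    rw [inv_pow, ← one_div, le_div_iff₀ (by positivity)]
    linarith
  rw [dist_eq_norm]
  calc ‖x - y‖ ≤ ∑ i, ‖(x - y) i‖ := by
        rw [EuclideanSpace.norm_eq]
        apply Real.sqrt_le_iff.mpr
        refine ⟨Finset.sum_nonneg fun _ _ => norm_nonneg _, ?_⟩
        exact Finset.sum_sq_le_sq_sum_of_nonneg fun _ _ => norm_nonneg _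
    _ ≤ ∑ _i : Fin n, (2 : ℝ)⁻¹ ^ j := Finset.sum_le_sum fun i _ => by simpa using hc i
    _ = n * (2 : ℝ)⁻¹ ^ j := by simp

lemma le_dimH_of_sum {n : ℕ} (κ : Measure (EuclideanSpace ℝ (Fin n))) [IsProbabilityMeasure κ]
    (S : Set (EuclideanSpace ℝ (Fin n))) (hS : κ Sᶜ = 0) (t : ℝ≥0) (ht : 0 < t)
    (hsum : ∑' j : ℕ, ∑' k : Fin n → ℤ,
      (2 : ℝ≥0∞) ^ (j * (t : ℝ)) * κ (cubeIdx j ⁻¹' {k}) ^ 2 ≠ ∞) :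
    (t : ℝ≥0∞) ≤ dimH S := by
  set φ : EuclideanSpace ℝ (Fin n) → ℝ≥0∞ := fun x =>
    ∑' j : ℕ, (2 : ℝ≥0∞) ^ (j * (t : ℝ)) * κ (cubeIdx j ⁻¹' {cubeIdx j x}) with hφ
  have hmeas : ∀ j : ℕ, Measurable fun x : EuclideanSpace ℝ (Fin n) =>
      (2 : ℝ≥0∞) ^ (j * (t : ℝ)) * κ (cubeIdx j ⁻¹' {cubeIdx j x}) := by
    intro j
    have : Measurable fun k : Fin n → ℤ =>
      (2 : ℝ≥0∞) ^ (j * (t : ℝ)) * κ (cubeIdx j ⁻¹' {k}) := Measurable.of_discrete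
    exact this.comp (measurable_cubeIdx j)
  have hφm : Measurable φ := Measurable.tsum hmeas
  have hintg : ∫⁻ x, φ x ∂κ ≠ ∞ := by
    rw [hφ, lintegral_tsum fun j => (hmeas j).aemeasurable]
    convert hsum using 3 with j
    have h1 : Measurable fun k : Fin n → ℤ =>
      (2 : ℝ≥0∞) ^ (j * (t : ℝ)) * κ (cubeIdx j ⁻¹' {k}) := Measurable.of_discrete
    rw [← lintegral_map h1 (measurable_cubeIdx j), lintegral_countable']
    refine tsum_congr fun k => ?_
    rw [Measure.map_apply (measurable_cubeIdx j) (measurableSet_singleton k)]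
    ring
  have hfin : ∀ᵐ x ∂κ, φ x < ∞ := ae_lt_top hφm hintg
  obtain ⟨M, hM⟩ : ∃ M : ℕ, κ {x | φ x ≤ M} ≠ 0 := by
    by_contra! hcon
    have : κ (⋃ M : ℕ, {x | φ x ≤ M}) = 0 := measure_iUnion_null hcon
    have h2 : ∀ᵐ x ∂κ, False := by
      have h3 : ∀ᵐ x ∂κ, x ∉ ⋃ M : ℕ, {x | φ x ≤ M} := measure_eq_zero_iff_ae_notMem.mp this
      filter_upwards [hfin, h3] with x hx hx3
      obtain ⟨N, hN⟩ := ENNReal.exists_nat_gt hx.ne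
      exact hx3 (Set.mem_iUnion.mpr ⟨N, hN.le⟩)
    have := h2.exists
    simp at this
  set F := {x | φ x ≤ M} with hF
  have hFm : MeasurableSet F := measurableSet_le hφm measurable_const
  set M' : ℝ≥0∞ := 3 ^ n * (M + 1) with hM'
  have hcube : ∀ j k, κ (cubeIdx j ⁻¹' {k} ∩ F) ≤ (M + 1) * (2 : ℝ≥0∞) ^ (-(j * (t : ℝ))) := by
    intro j k
    rcases (cubeIdx j ⁻¹' {k} ∩ F).eq_empty_or_nonempty with h | ⟨x, hxk, hxF⟩
    · rw [h]; simp
    · have hxk' : cubeIdx j x = k := hxk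
      have h1 : (2 : ℝ≥0∞) ^ (j * (t : ℝ)) * κ (cubeIdx j ⁻¹' {k}) ≤ M := by
        rw [← hxk']
        exact (ENNReal.le_tsum (f := fun j : ℕ =>
          (2 : ℝ≥0∞) ^ (j * (t : ℝ)) * κ (cubeIdx j ⁻¹' {cubeIdx j x})) j).trans hxF
      calc κ (cubeIdx j ⁻¹' {k} ∩ F) ≤ κ (cubeIdx j ⁻¹' {k}) := measure_mono Set.inter_subset_left
        _ = ((2 : ℝ≥0∞) ^ (j * (t : ℝ)) * κ (cubeIdx j ⁻¹' {k})) * (2 : ℝ≥0∞) ^ (-(j * (t : ℝ))) := by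
            rw [mul_comm, ← mul_assoc, ← ENNReal.rpow_add _ _ (by simp) (by simp)]
            simp
        _ ≤ (M + 1) * (2 : ℝ≥0∞) ^ (-(j * (t : ℝ))) := by
            gcongr
            exact h1.trans le_self_add
  have hset : ∀ (j : ℕ) (E : Set (EuclideanSpace ℝ (Fin n))), ediam E ≤ (2 : ℝ≥0∞)⁻¹ ^ j →
      κ (E ∩ F) ≤ M' * (2 : ℝ≥0∞) ^ (-(j * (t : ℝ))) := by
    intro j E hE
    rcases (E ∩ F).eq_empty_or_nonempty with h | ⟨x, hxE, hxF⟩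
    · rw [h]; simp
    have hsub : E ∩ F ⊆ ⋃ e ∈ nbrs n, (cubeIdx j ⁻¹' {cubeIdx j x + e} ∩ F) := by
      rintro y ⟨hyE, hyF⟩
      simp only [Set.mem_iUnion]
      have hd : dist x y ≤ (2 : ℝ)⁻¹ ^ j := by
        have h1 := (edist_le_ediam_of_mem hxE hyE).trans hE
        rw [edist_dist] at h1
        have h2 : (2 : ℝ≥0∞)⁻¹ ^ j = ENNReal.ofReal ((2 : ℝ)⁻¹ ^ j) := by
          rw [ENNReal.ofReal_pow (by norm_num), ENNReal.ofReal_inv_of_pos (by norm_num)]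
          simp
        rw [h2] at h1
        exact (ENNReal.ofReal_le_ofReal_iff (by positivity)).mp h1
      refine ⟨_, cubeIdx_sub_mem j x y hd, ?_, hyF⟩
      simp
    calc κ (E ∩ F) ≤ κ (⋃ e ∈ nbrs n, (cubeIdx j ⁻¹' {cubeIdx j x + e} ∩ F)) := measure_mono hsub
      _ ≤ ∑ e ∈ nbrs n, κ (cubeIdx j ⁻¹' {cubeIdx j x + e} ∩ F) := measure_biUnion_finset_le _ _
      _ ≤ ∑ e ∈ nbrs n, (M + 1) * (2 : ℝ≥0∞) ^ (-(j * (t : ℝ))) :=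
          Finset.sum_le_sum fun e _ => hcube j _
      _ = M' * (2 : ℝ≥0∞) ^ (-(j * (t : ℝ))) := by
          rw [Finset.sum_const, card_nbrs, hM', nsmul_eq_mul]
          push_cast
          ring
  have hM'0 : M' ≠ 0 := by simp [hM']
  have hM't : M' ≠ ∞ := by
    rw [hM']
    exact ENNReal.mul_ne_top (by simp) (by simp)
  have ht' : (0 : ℝ) < t := ht
  set D : ℝ≥0∞ := M' * 2 ^ (t : ℝ) with hD
  have h2t0 : (2 : ℝ≥0∞) ^ (t : ℝ) ≠ 0 := by simp
  have h2tt : (2 : ℝ≥0∞) ^ (t : ℝ) ≠ ∞ := by simp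
  have hD0 : D ≠ 0 := mul_ne_zero hM'0 h2t0
  have hDt : D ≠ ∞ := ENNReal.mul_ne_top hM't h2tt
  have hle : D⁻¹ • (κ.restrict F) ≤ μH[(t : ℝ)] := by
    refine Measure.le_hausdorffMeasure _ _ 1 one_pos fun E hE => ?_
    rw [Measure.smul_apply, Measure.restrict_apply' hFm, smul_eq_mul]
    rw [mul_comm, ← div_eq_mul_inv, ENNReal.div_le_iff hD0 hDt]
    by_cases h0 : ediam E = 0
    · have hlim : Tendsto (fun j : ℕ => M' * (2 : ℝ≥0∞) ^ (-(j * (t : ℝ)))) atTop (𝓝 (M' * 0)) := by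
        refine ENNReal.Tendsto.const_mul ?_ (Or.inr hM't)
        have : (fun j : ℕ => (2 : ℝ≥0∞) ^ (-(j * (t : ℝ)))) =
            fun j : ℕ => ((2 : ℝ≥0∞) ^ (-(t : ℝ))) ^ j := by
          funext j
          rw [← ENNReal.rpow_natCast, ← ENNReal.rpow_mul]
          congr 1; ring
        rw [this]
        refine ENNReal.tendsto_pow_atTop_nhds_zero_of_lt_one ?_
        exact ENNReal.rpow_lt_one_of_one_lt_of_neg (by norm_num) (by linarith)
      have : κ (E ∩ F) ≤ M' * 0 := ge_of_tendsto' hlim fun j => hset j E (by rw [h0]; exact zero_le)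
      rw [mul_zero] at this
      exact this.trans zero_le
    · obtain ⟨j, hj1, hj2⟩ : ∃ j : ℕ, ediam E ≤ (2 : ℝ≥0∞)⁻¹ ^ j ∧ (2 : ℝ≥0∞)⁻¹ ^ (j + 1) < ediam E := by
        have hex : ∃ j : ℕ, (2 : ℝ≥0∞)⁻¹ ^ j < ediam E := by
          have := ENNReal.tendsto_pow_atTop_nhds_zero_of_lt_one (r := (2 : ℝ≥0∞)⁻¹) (by simp)
          exact (this.eventually (gt_mem_nhds (pos_iff_ne_zero.mpr h0))).exists
        classical
        set J := Nat.find hex with hJ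
        have hJs := Nat.find_spec hex
        have hJ0 : J ≠ 0 := by
          intro h
          rw [← hJ, h, pow_zero] at hJs
          exact absurd hE (not_le.mpr hJs)
        obtain ⟨i, hi⟩ := Nat.exists_eq_succ_of_ne_zero hJ0
        refine ⟨i, ?_, ?_⟩
        · have := Nat.find_min hex (m := i) (by omega)
          exact not_lt.mp this
        · rw [← hJ, hi] at hJs
          exact hJs
      refine (hset j E hj1).trans ?_
      have e1 : (2 : ℝ≥0∞) ^ (-(j * (t : ℝ))) = ((2 : ℝ≥0∞)⁻¹ ^ (j + 1)) ^ (t : ℝ) * 2 ^ (t : ℝ) := by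
        rw [← ENNReal.rpow_natCast, ← ENNReal.rpow_neg_one, ← ENNReal.rpow_mul, ← ENNReal.rpow_mul,
          ← ENNReal.rpow_add _ _ (by simp) (by simp)]
        congr 1
        push_cast
        ring
      rw [e1, hD]
      calc M' * (((2 : ℝ≥0∞)⁻¹ ^ (j + 1)) ^ (t : ℝ) * 2 ^ (t : ℝ))
          = ((2 : ℝ≥0∞)⁻¹ ^ (j + 1)) ^ (t : ℝ) * (M' * 2 ^ (t : ℝ)) := by ring
        _ ≤ _ := by gcongr
  apply le_dimH_of_hausdorffMeasure_ne_zero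
  intro h0
  have h1 := hle S
  rw [h0, Measure.smul_apply, Measure.restrict_apply' hFm, smul_eq_mul] at h1
  have h2 : κ (S ∩ F) = 0 := by
    rcases mul_eq_zero.mp (le_antisymm h1 zero_le) with h | h
    · exact absurd h (ENNReal.inv_ne_zero.mpr hDt)
    · exact h
  apply hM
  have : F ⊆ (S ∩ F) ∪ Sᶜ := by
    intro x hx
    by_cases hxS : x ∈ S
    · exact Or.inl ⟨hxS, hx⟩
    · exact Or.inr hxS
  exact measure_mono_null this (measure_union_null h2 hS)

lemma slices_dim {n m : ℕ} (μ : Measure (EuclideanSpace ℝ (Fin n))) [IsFiniteMeasure μ]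
    (f : EuclideanSpace ℝ (Fin n) → EuclideanSpace ℝ (Fin m)) (hf : Measurable f)
    (v : Measure (EuclideanSpace ℝ (Fin m))) [IsFiniteMeasure v]
    (hac : μ.map f ≪ v) (A : Set (EuclideanSpace ℝ (Fin n))) (hA : MeasurableSet A)
    (hμA : μ Aᶜ = 0) (t : ℝ≥0) (ht : 0 < t)
    (g : ℕ → (Fin n → ℤ) → EuclideanSpace ℝ (Fin m) → ℝ≥0∞)
    (hg : ∀ j k, Measurable (g j k))
    (hgd : ∀ j k, (μ.restrict (cubeIdx j ⁻¹' {k})).map f = v.withDensity (g j k))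
    (hsum : ∑' j : ℕ, (2 : ℝ≥0∞) ^ (j * (t : ℝ)) * ∑' k, ∫⁻ u, g j k u ^ 2 ∂v ≠ ∞) :
    ∀ᵐ u ∂(μ.map f), (t : ℝ≥0∞) ≤ dimH (f ⁻¹' {u} ∩ A) := by
  set ρ : Measure (EuclideanSpace ℝ (Fin m) × EuclideanSpace ℝ (Fin n)) :=
    μ.map (fun x => (f x, x)) with hρ
  have hfm : Measurable (fun x => (f x, x)) := hf.prodMk measurable_id
  have : IsFiniteMeasure ρ := by rw [hρ]; infer_instance
  have : IsFiniteMeasure (μ.map f) := by infer_instance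
  have hfst : ρ.fst = μ.map f := by
    rw [hρ, Measure.fst, Measure.map_map measurable_fst hfm]; rfl
  set h := (μ.map f).rnDeriv v with hh
  have hhm : Measurable h := Measure.measurable_rnDeriv _ _
  have hhd : v.withDensity h = μ.map f := Measure.withDensity_rnDeriv_eq _ _ hac
  have hQm : ∀ j (k : Fin n → ℤ), MeasurableSet
      (cubeIdx j ⁻¹' {k} : Set (EuclideanSpace ℝ (Fin n))) :=
    fun j k => measurable_cubeIdx j (measurableSet_singleton k)
  have hκm : ∀ j k, Measurable fun u => ρ.condKernel u (cubeIdx j ⁻¹' {k}) :=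
    fun j k => ProbabilityTheory.Kernel.measurable_coe _ (hQm j k)
  have key : ∀ j k, ∀ᵐ u ∂v, g j k u = h u * ρ.condKernel u (cubeIdx j ⁻¹' {k}) := by
    intro j k
    have hfinite : ∫⁻ u, g j k u ∂v ≠ ∞ := by
      have : v.withDensity (g j k) Set.univ ≠ ∞ := by
        rw [← hgd j k]
        exact measure_ne_top _ _
      rwa [withDensity_apply _ MeasurableSet.univ, Measure.restrict_univ] at this
    refine (withDensity_eq_iff (hg j k).aemeasurable (hhm.mul (hκm j k)).aemeasurable hfinite).mp ?_
    rw [← hgd j k]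
    change _ = v.withDensity (h * fun u => ρ.condKernel u (cubeIdx j ⁻¹' {k}))
    rw [withDensity_mul _ hhm (hκm j k), hhd]
    ext E hE
    rw [Measure.map_apply hf hE, Measure.restrict_apply (hf hE), withDensity_apply _ hE, ← hfst,
      Measure.setLIntegral_condKernel_eq_measure_prod hE (hQm j k), hρ,
      Measure.map_apply hfm (hE.prod (hQm j k))]
    rfl
  have hsum' : ∀ᵐ u ∂v, ∑' j : ℕ, (2 : ℝ≥0∞) ^ (j * (t : ℝ)) * ∑' k, g j k u ^ 2 < ∞ := by
    refine ae_lt_top ?_ ?_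
    · refine Measurable.tsum fun j => Measurable.const_mul ?_ _
      exact Measurable.tsum fun k => (hg j k).pow_const 2
    · rw [lintegral_tsum]
      · convert hsum using 3 with j
        rw [lintegral_const_mul, lintegral_tsum]
        · exact fun k => ((hg j k).pow_const 2).aemeasurable
        · exact Measurable.tsum fun k => (hg j k).pow_const 2
      · intro j
        refine (Measurable.const_mul ?_ _).aemeasurable
        exact Measurable.tsum fun k => (hg j k).pow_const 2
  have hkey : ∀ᵐ u ∂v, ∀ j k, g j k u = h u * ρ.condKernel u (cubeIdx j ⁻¹' {k}) :=
    ae_all_iff.mpr fun j => ae_all_iff.mpr fun k => key j k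
  have hne : ∀ᵐ u ∂(μ.map f), h u ≠ 0 := by
    rw [← hhd, ae_withDensity_iff hhm]
    exact Eventually.of_forall fun u hu => hu
  have hconc : ∀ᵐ u ∂(μ.map f), ρ.condKernel u (f ⁻¹' {u} ∩ A)ᶜ = 0 := by
    set B : Set (EuclideanSpace ℝ (Fin m) × EuclideanSpace ℝ (Fin n)) :=
      {p | f p.2 = p.1 ∧ p.2 ∈ A} with hB
    have hBm : MeasurableSet B := by
      refine MeasurableSet.inter ?_ (measurable_snd hA)
      exact measurableSet_eq_fun (hf.comp measurable_snd) measurable_fst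
    have h1 := Measure.lintegral_condKernel_mem (ρ := ρ) hBm.compl
    have h2 : ρ Bᶜ = 0 := by
      rw [hρ, Measure.map_apply hfm hBm.compl]
      convert hμA using 2
      ext x; simp [hB]
    rw [h2, lintegral_eq_zero_iff, hfst] at h1
    · filter_upwards [h1] with u hu
      exact hu
    · exact ProbabilityTheory.Kernel.measurable_kernel_prodMk_left hBm.compl
  filter_upwards [hac.ae_le hsum', hac.ae_le hkey, hne, hconc] with u h1 h2 h3 h4
  refine le_dimH_of_sum (ρ.condKernel u) _ h4 t ht ?_
  have e : ∑' j : ℕ, (2 : ℝ≥0∞) ^ (j * (t : ℝ)) * ∑' k, g j k u ^ 2 = h u ^ 2 * 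
      ∑' j : ℕ, ∑' k : Fin n → ℤ,
      (2 : ℝ≥0∞) ^ (j * (t : ℝ)) * ρ.condKernel u (cubeIdx j ⁻¹' {k}) ^ 2 := by
    rw [← ENNReal.tsum_mul_left]
    refine tsum_congr fun j => ?_
    rw [← ENNReal.tsum_mul_left, ← ENNReal.tsum_mul_left]
    refine tsum_congr fun k => ?_
    rw [h2 j k]
    ring
  rw [e] at h1
  intro hcon
  rw [hcon, ENNReal.mul_top (pow_ne_zero 2 h3)] at h1
  exact lt_irrefl _ h1

lemma IsOrthoProj.norm_le {n m : ℕ} {P : EuclideanSpace ℝ (Fin n) →ₗ[ℝ] EuclideanSpace ℝ (Fin m)}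
    (hP : IsOrthoProj P) (x : EuclideanSpace ℝ (Fin n)) : ‖P x‖ ≤ ‖x‖ := by
  obtain ⟨y, hy, z, hz, rfl⟩ := (LinearMap.ker P).exists_add_mem_mem_orthogonal x
  have hy0 : P y = 0 := hy
  rw [map_add, hy0, zero_add, hP.2 z hz]
  have h := norm_add_sq_eq_norm_sq_add_norm_sq_of_inner_eq_zero y z (hz y hy)
  nlinarith [norm_nonneg (y + z), norm_nonneg z, mul_self_nonneg ‖y‖]

lemma slice_upper {n m : ℕ} {s : ℝ} (hs : (m : ℝ) < s)
    (f : EuclideanSpace ℝ (Fin n) → EuclideanSpace ℝ (Fin m))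
    (hf : ∀ x y, edist (f x) (f y) ≤ edist x y) (A : Set (EuclideanSpace ℝ (Fin n)))
    (hA : μH[s] A < ∞) :
    ∀ᵐ u : EuclideanSpace ℝ (Fin m), dimH (f ⁻¹' {u} ∩ A) ≤ ENNReal.ofReal (s - m) := by
  have hsm : 0 < s - m := by linarith
  have hcov : ∀ i : ℕ, ∃ t : ℕ → Set (EuclideanSpace ℝ (Fin n)), A ⊆ ⋃ k, t k ∧
      (∀ k, ediam (t k) ≤ ((i : ℝ≥0∞) + 1)⁻¹) ∧
      ∑' k, ediam (t k) ^ s ≤ μH[s] A + 1 := by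
    intro i
    have h1 : μH[s] A < μH[s] A + 1 := ENNReal.lt_add_right hA.ne one_ne_zero
    have hr : (0 : ℝ≥0∞) < ((i : ℝ≥0∞) + 1)⁻¹ := by
      rw [ENNReal.inv_pos]; simp
    rw [Measure.hausdorffMeasure_apply] at h1
    have h3 := (le_iSup₂ (f := fun (r : ℝ≥0∞) (_ : 0 < r) =>
      ⨅ (t : ℕ → Set (EuclideanSpace ℝ (Fin n))), ⨅ (_ : A ⊆ ⋃ n, t n),
        ⨅ (_ : ∀ (n : ℕ), ediam (t n) ≤ r), ∑' (n : ℕ), ⨆ (_ : (t n).Nonempty), ediam (t n) ^ s)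
      ((i : ℝ≥0∞) + 1)⁻¹ hr).trans_lt h1
    simp only [iInf_lt_iff] at h3
    obtain ⟨t, ht1, ht2, ht3⟩ := h3
    refine ⟨t, ht1, ht2, ?_⟩
    rw [Measure.hausdorffMeasure_apply]
    refine le_trans (ENNReal.tsum_le_tsum fun k => ?_) ht3.le
    rcases (t k).eq_empty_or_nonempty with h | h
    · rw [h, ediam_empty, ENNReal.zero_rpow_of_pos (by linarith [(Nat.cast_nonneg m : (0:ℝ) ≤ m)])]
      exact zero_le
    · simp [h]
  choose t ht1 ht2 ht3 using hcov
  set c : ℝ≥0∞ := volume (ball (0 : EuclideanSpace ℝ (Fin m)) 1) with hc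
  have hct : c ≠ ∞ := measure_ball_lt_top.ne
  have hball : ∀ i k, ∃ B : Set (EuclideanSpace ℝ (Fin m)), MeasurableSet B ∧ f '' (t i k) ⊆ B ∧
      volume B ≤ c * ediam (t i k) ^ (m : ℝ) := by
    intro i k
    rcases (t i k).eq_empty_or_nonempty with h | ⟨x, hx⟩
    · exact ⟨∅, MeasurableSet.empty, by simp [h], by simp⟩
    · have hfin : ediam (t i k) ≠ ∞ := by
        refine ((ht2 i k).trans_lt ?_).ne
        simp
      refine ⟨closedBall (f x) (ediam (t i k)).toReal, measurableSet_closedBall, ?_, ?_⟩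
      · rintro _ ⟨y, hy, rfl⟩
        rw [mem_closedBall, dist_edist]
        exact ENNReal.toReal_mono hfin ((hf y x).trans (edist_le_ediam_of_mem hy hx))
      · rw [Measure.addHaar_closedBall _ _ ENNReal.toReal_nonneg, mul_comm, finrank_euclideanSpace_fin,
          ENNReal.ofReal_pow ENNReal.toReal_nonneg, ENNReal.ofReal_toReal hfin, ENNReal.rpow_natCast]
  choose B hBm hBs hBv using hball
  set F : ℕ → EuclideanSpace ℝ (Fin m) → ℝ≥0∞ := fun i u =>
    ∑' k, (B i k).indicator (fun _ => ediam (t i k) ^ (s - m)) u with hF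
  have hFm : ∀ i, Measurable (F i) := fun i =>
    Measurable.tsum fun k => measurable_const.indicator (hBm i k)
  have hFi : ∀ i, ∫⁻ u, F i u ≤ c * (μH[s] A + 1) := by
    intro i
    rw [hF, lintegral_tsum fun k => (measurable_const.indicator (hBm i k)).aemeasurable]
    calc ∑' k, ∫⁻ u, (B i k).indicator (fun _ => ediam (t i k) ^ (s - m)) u
        ≤ ∑' k, c * ediam (t i k) ^ s := by
          refine ENNReal.tsum_le_tsum fun k => ?_
          rw [lintegral_indicator (hBm i k), setLIntegral_const]
          calc _ ≤ ediam (t i k) ^ (s - m) * (c * ediam (t i k) ^ (m : ℝ)) := by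
                gcongr; exact hBv i k
            _ = c * (ediam (t i k) ^ (s - m) * ediam (t i k) ^ (m : ℝ)) := by ring
            _ = c * ediam (t i k) ^ s := by
              rw [← ENNReal.rpow_add_of_nonneg _ _ hsm.le (Nat.cast_nonneg m)]
              simp
      _ = c * ∑' k, ediam (t i k) ^ s := ENNReal.tsum_mul_left
      _ ≤ _ := by gcongr; exact ht3 i
  have hlim : ∫⁻ u, liminf (fun i => F i u) atTop ≠ ∞ := by
    refine ((lintegral_liminf_le hFm).trans ?_).trans_lt
      (ENNReal.mul_lt_top hct.lt_top (ENNReal.add_lt_top.mpr ⟨hA, ENNReal.one_lt_top⟩)) |>.ne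
    refine (liminf_le_liminf (Eventually.of_forall hFi)).trans ?_
    simp
  have hfinite := ae_lt_top (Measurable.liminf hFm) hlim
  filter_upwards [hfinite] with u hu
  have hd : ((s - m).toNNReal : ℝ) = s - m := Real.coe_toNNReal _ hsm.le
  refine dimH_le_of_hausdorffMeasure_ne_top (d := (s - m).toNNReal) ?_
  rw [hd]
  refine (lt_of_le_of_lt ?_ hu).ne
  have hr0 : Tendsto (fun i : ℕ => ((i : ℝ≥0∞) + 1)⁻¹) atTop (𝓝 0) := by
    have := ENNReal.tendsto_inv_nat_nhds_zero.comp (tendsto_add_atTop_nat 1)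
    refine this.congr fun i => ?_
    simp
  refine (Measure.hausdorffMeasure_le_liminf_tsum (s - m) (f ⁻¹' {u} ∩ A) (l := atTop) _ hr0
    (fun i k => t i k ∩ f ⁻¹' {u}) (Eventually.of_forall fun i k =>
      (ediam_mono Set.inter_subset_left).trans (ht2 i k))
    (Eventually.of_forall fun i x hx => ?_)).trans ?_
  · obtain ⟨k, hk⟩ := Set.mem_iUnion.mp (ht1 i hx.2)
    exact Set.mem_iUnion.mpr ⟨k, hk, hx.1⟩
  · refine liminf_le_liminf (Eventually.of_forall fun i => ?_)
    refine ENNReal.tsum_le_tsum fun k => ?_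
    by_cases hk : u ∈ B i k
    · rw [Set.indicator_of_mem hk]
      exact ENNReal.rpow_le_rpow (ediam_mono Set.inter_subset_left) hsm.le
    · have : t i k ∩ f ⁻¹' {u} = ∅ := by
        rw [Set.eq_empty_iff_forall_notMem]
        rintro x ⟨hx1, hx2⟩
        have hx2' : f x = u := hx2
        exact hk (hBs i k ⟨x, hx1, hx2'⟩)
      rw [this, ediam_empty, ENNReal.zero_rpow_of_pos hsm]
      exact zero_le

lemma upper_dens_null {n : ℕ} {s : ℝ} (hs : 0 < s) (A : Set (EuclideanSpace ℝ (Fin n)))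
    (hA : μH[s] A < ∞) :
    μH[s] {x | x ∈ A ∧ ¬ ∃ k : ℕ, ∀ r : ℝ, 0 < r → r < 1 / ((k : ℝ) + 1) →
      μH[s] (A ∩ closedBall x r) ≤ k * ENNReal.ofReal (r ^ s)} = 0 := by
  set Z := {x | x ∈ A ∧ ¬ ∃ k : ℕ, ∀ r : ℝ, 0 < r → r < 1 / ((k : ℝ) + 1) →
      μH[s] (A ∩ closedBall x r) ≤ k * ENNReal.ofReal (r ^ s)} with hZ
  have h1 : ∀ k : ℕ, ∀ x : EuclideanSpace ℝ (Fin n), ∃ r : ℝ, x ∈ Z →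
      0 < r ∧ r < 1 / ((k : ℝ) + 1) ∧ k * ENNReal.ofReal (r ^ s) ≤ μH[s] (A ∩ closedBall x r) := by
    intro k x
    by_cases hx : x ∈ Z
    · have := hx.2
      push Not at this
      obtain ⟨r, hr0, hr1, hr2⟩ := this k
      exact ⟨r, fun _ => ⟨hr0, hr1, hr2.le⟩⟩
    · exact ⟨0, fun h => absurd h hx⟩
  choose r hr using h1
  have h2 : ∀ k : ℕ, ∃ u ⊆ Z, (u.PairwiseDisjoint fun a => closedBall a (r k a)) ∧
      ∀ a ∈ Z, ∃ b ∈ u, closedBall a (r k a) ⊆ closedBall b (5 * r k b) := by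
    intro k
    refine Vitali.exists_disjoint_subfamily_covering_enlargement_closedBall Z
      (fun x => x) (r k) (1 / ((k : ℝ) + 1)) (fun a ha => (hr k a ha).2.1.le) 5 (by norm_num)
  choose u huZ hud hucov using h2
  have hcount : ∀ k, Countable (u k) := by
    intro k
    refine (Set.PairwiseDisjoint.countable_of_nonempty_interior (hud k) fun a ha => ?_).to_subtype
    refine ⟨a, ball_subset_interior_closedBall (mem_ball_self (hr k a (huZ k ha)).1)⟩
  have hr0 : Tendsto (fun k : ℕ => 10 * ((k : ℝ≥0∞) + 1)⁻¹) atTop (𝓝 0) := by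
    have := ENNReal.tendsto_inv_nat_nhds_zero.comp (tendsto_add_atTop_nat 1)
    have h3 := ENNReal.Tendsto.const_mul (a := 10) this (Or.inr (by norm_num))
    rw [mul_zero] at h3
    refine h3.congr fun i => ?_
    simp
  have hdiam : ∀ k (b : u k), ediam (closedBall (b : EuclideanSpace ℝ (Fin n)) (5 * r k b)) ≤
      10 * ENNReal.ofReal (r k b) := by
    intro k b
    have hb := (hr k b (huZ k b.2)).1
    refine ediam_le fun x hx y hy => ?_
    have h10 : (10 : ℝ≥0∞) = ENNReal.ofReal 10 := by simp
    rw [edist_dist, h10, ← ENNReal.ofReal_mul (by norm_num)]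
    apply ENNReal.ofReal_le_ofReal
    have e1 := mem_closedBall.mp hx
    have e2 := mem_closedBall'.mp hy
    linarith [dist_triangle x (b : EuclideanSpace ℝ (Fin n)) y]
  have hsum : ∀ k : ℕ, k ≠ 0 →
      ∑' b : u k, ediam (closedBall (b : EuclideanSpace ℝ (Fin n)) (5 * r k b)) ^ s ≤
        10 ^ s * μH[s] A * ((k : ℝ≥0∞))⁻¹ := by
    intro k hk
    have hk0 : (k : ℝ≥0∞) ≠ 0 := by exact_mod_cast hk
    have hkt : (k : ℝ≥0∞) ≠ ∞ := ENNReal.natCast_ne_top k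
    calc _ ≤ ∑' b : u k, 10 ^ s * (k : ℝ≥0∞)⁻¹ *
          (μH[s].restrict A) (closedBall (b : EuclideanSpace ℝ (Fin n)) (r k b)) := by
          refine ENNReal.tsum_le_tsum fun b => ?_
          have hb := hr k b (huZ k b.2)
          refine (ENNReal.rpow_le_rpow (hdiam k b) hs.le).trans ?_
          rw [ENNReal.mul_rpow_of_nonneg _ _ hs.le, mul_assoc]
          gcongr
          rw [Measure.restrict_apply measurableSet_closedBall, Set.inter_comm,
            ENNReal.ofReal_rpow_of_pos hb.1, mul_comm, ← div_eq_mul_inv,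
            ENNReal.le_div_iff_mul_le (Or.inl hk0) (Or.inl hkt), mul_comm]
          exact hb.2.2
      _ = 10 ^ s * (k : ℝ≥0∞)⁻¹ * ∑' b : u k,
          (μH[s].restrict A) (closedBall (b : EuclideanSpace ℝ (Fin n)) (r k b)) :=
          ENNReal.tsum_mul_left
      _ ≤ 10 ^ s * (k : ℝ≥0∞)⁻¹ * μH[s] A := by
          gcongr
          rw [← measure_iUnion]
          · exact (measure_mono (Set.subset_univ _)).trans (by simp)
          · intro a b hab
            exact hud k a.2 b.2 (fun h => hab (Subtype.ext h))
          · exact fun b => measurableSet_closedBall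
      _ = _ := by ring
  have hle := Measure.hausdorffMeasure_le_liminf_tsum s Z (l := atTop) _ hr0
    (fun (k : ℕ) (b : u k) => closedBall (b : EuclideanSpace ℝ (Fin n)) (5 * r k b))
    (Eventually.of_forall fun k b => (hdiam k b).trans (by
      gcongr
      have hb := (hr k b (huZ k b.2)).2.1
      calc ENNReal.ofReal (r k b) ≤ ENNReal.ofReal (1 / ((k : ℝ) + 1)) :=
            ENNReal.ofReal_le_ofReal hb.le
        _ = _ := by
          rw [one_div, ENNReal.ofReal_inv_of_pos (by positivity),
            ENNReal.ofReal_add (by positivity) (by norm_num)]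
          simp))
    (Eventually.of_forall fun k x hx => by
      obtain ⟨b, hb, hsub⟩ := hucov k x hx
      exact Set.mem_iUnion.mpr ⟨⟨b, hb⟩, hsub (mem_closedBall_self (hr k x hx).1.le)⟩)
  have hlim : Tendsto (fun k : ℕ => 10 ^ s * μH[s] A * ((k : ℝ≥0∞))⁻¹) atTop (𝓝 0) := by
    have := ENNReal.Tendsto.const_mul (a := 10 ^ s * μH[s] A) ENNReal.tendsto_inv_nat_nhds_zero
      (Or.inr (ENNReal.mul_ne_top (ENNReal.rpow_ne_top_of_nonneg hs.le (by norm_num)) hA.ne))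
    rwa [mul_zero] at this
  have hle2 : liminf (fun k : ℕ =>
      ∑' b : u k, ediam (closedBall (b : EuclideanSpace ℝ (Fin n)) (5 * r k b)) ^ s) atTop ≤ 0 := by
    rw [← hlim.liminf_eq]
    refine liminf_le_liminf ?_
    filter_upwards [eventually_ne_atTop 0] with k hk using hsum k hk
  exact le_antisymm (hle.trans hle2) zero_le

lemma exists_good_subset {n : ℕ} {s : ℝ} (hs : 0 < s) (A : Set (EuclideanSpace ℝ (Fin n)))
    (hAm : NullMeasurableSet A μH[s]) (hA0 : 0 < μH[s] A) (hA : μH[s] A < ∞)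
    (hld : ∀ᵐ x ∂(μH[s].restrict A), 0 < lowerDensity s A x) :
    ∃ A' ⊆ A, MeasurableSet A' ∧ μH[s] A' ≠ 0 ∧ (∃ N : ℝ, 0 < N ∧ A' ⊆ closedBall 0 N) ∧
      (∃ K : ℝ≥0∞, K ≠ 0 ∧ K ≠ ∞ ∧ ∀ z r, 0 < r →
        μH[s] (A' ∩ closedBall z r) ≤ K * ENNReal.ofReal (r ^ s)) ∧
      (∃ c : ℝ≥0∞, c ≠ 0 ∧ c ≠ ∞ ∧ ∀ x ∈ A', ∀ r, 0 < r → r ≤ 1 →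
        c * ENNReal.ofReal (r ^ s) ≤ μH[s] (A ∩ closedBall x r)) := by
  set G : ℕ → Set (EuclideanSpace ℝ (Fin n)) := fun k => {x | x ∈ A ∧ ∀ r : ℝ, 0 < r →
    r < 1 / ((k : ℝ) + 1) → ENNReal.ofReal (r ^ s) ≤ k * μH[s] (A ∩ closedBall x r) ∧
      μH[s] (A ∩ closedBall x r) ≤ k * ENNReal.ofReal (r ^ s)} with hG
  have hnull1 := upper_dens_null hs A hA
  have hnull2 := (ae_restrict_iff'₀ hAm).mp hld
  obtain ⟨k, hk⟩ : ∃ k, μH[s] (G k) ≠ 0 := by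
    by_contra! hcon
    have hU : μH[s] (⋃ k, G k) = 0 := measure_iUnion_null hcon
    have h1 : ∀ᵐ x ∂μH[s], x ∉ ⋃ k, G k := measure_eq_zero_iff_ae_notMem.mp hU
    have h2 := measure_eq_zero_iff_ae_notMem.mp hnull1
    have h3 : ∀ᵐ x ∂μH[s], x ∉ A := by
      filter_upwards [h1, h2, hnull2] with x hx1 hx2 hx3 hxA
      apply hx1
      have hx4 : ∃ k : ℕ, ∀ r : ℝ, 0 < r → r < 1 / ((k : ℝ) + 1) →
          μH[s] (A ∩ closedBall x r) ≤ k * ENNReal.ofReal (r ^ s) := by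
        by_contra hc
        exact hx2 ⟨hxA, hc⟩
      obtain ⟨k1, hk1⟩ := hx4
      have hx5 := hx3 hxA
      obtain ⟨a, ha0, ha1⟩ := exists_between hx5
      have hev := eventually_lt_of_lt_liminf ha1
      rw [eventually_nhdsWithin_iff, Metric.eventually_nhds_iff] at hev
      obtain ⟨ε, hε, hev⟩ := hev
      obtain ⟨k2, hk2⟩ := exists_nat_one_div_lt hε
      obtain ⟨k3, hk3⟩ := ENNReal.exists_nat_gt (ENNReal.inv_ne_top.mpr ha0.ne')
      refine Set.mem_iUnion.mpr ⟨k1 + k2 + k3, hxA, fun r hr0 hr1 => ⟨?_, ?_⟩⟩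
      · have hrε : r < ε := by
          refine hr1.trans (lt_of_le_of_lt ?_ hk2)
          apply one_div_le_one_div_of_le (by positivity)
          push_cast
          nlinarith [(Nat.cast_nonneg k1 : (0 : ℝ) ≤ k1), (Nat.cast_nonneg k3 : (0 : ℝ) ≤ k3)]
        have h6 := hev (y := r) (by rw [Real.dist_eq, sub_zero, abs_of_pos hr0]; exact hrε) hr0
        have h7 : a * ENNReal.ofReal ((2 * r) ^ s) ≤ μH[s] (A ∩ closedBall x r) :=
          ENNReal.mul_le_of_le_div h6.le
        have hat : a ≠ ∞ := ha1.ne_top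
        calc ENNReal.ofReal (r ^ s) ≤ ENNReal.ofReal ((2 * r) ^ s) := by
              apply ENNReal.ofReal_le_ofReal
              exact Real.rpow_le_rpow hr0.le (by linarith) hs.le
          _ = a⁻¹ * (a * ENNReal.ofReal ((2 * r) ^ s)) := by
              rw [← mul_assoc, ENNReal.inv_mul_cancel ha0.ne' hat, one_mul]
          _ ≤ ((k1 + k2 + k3 : ℕ) : ℝ≥0∞) * μH[s] (A ∩ closedBall x r) := by
              gcongr
              refine hk3.le.trans ?_
              exact_mod_cast (by omega : k3 ≤ k1 + k2 + k3)
      · refine (hk1 r hr0 (hr1.trans_le ?_)).trans ?_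
        · apply one_div_le_one_div_of_le (by positivity)
          push_cast
          nlinarith [(Nat.cast_nonneg k2 : (0 : ℝ) ≤ k2), (Nat.cast_nonneg k3 : (0 : ℝ) ≤ k3)]
        · gcongr
          omega
    exact hA0.ne' (measure_eq_zero_iff_ae_notMem.mpr h3)
  obtain ⟨A0, hA0s, hA0m, hA0e⟩ := hAm.exists_measurable_subset_ae_eq
  set A1 := A0 ∩ closure (G k) with hA1
  have hA1m : MeasurableSet A1 := hA0m.inter isClosed_closure.measurableSet
  have hA1ne : μH[s] A1 ≠ 0 := by
    have : A1 =ᵐ[μH[s]] (A ∩ closure (G k) : Set _) := hA0e.inter (ae_eq_refl _)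
    rw [measure_congr this]
    intro h0
    have hsub : G k ⊆ A ∩ closure (G k) := fun x hx => ⟨hx.1, subset_closure hx⟩
    exact hk (measure_mono_null hsub h0)
  obtain ⟨N, hN⟩ : ∃ N : ℕ, μH[s] (A1 ∩ closedBall 0 ((N : ℝ) + 1)) ≠ 0 := by
    by_contra! hcon
    apply hA1ne
    refine measure_mono_null ?_ (measure_iUnion_null hcon)
    intro x hx
    obtain ⟨N, hN⟩ := exists_nat_gt ‖x‖
    refine Set.mem_iUnion.mpr ⟨N, hx, ?_⟩
    rw [mem_closedBall_zero_iff]; linarith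
  set θ : ℝ := 1 / ((k : ℝ) + 1) with hθ
  have hθ0 : 0 < θ := by positivity
  have hθ1 : θ ≤ 1 := by
    rw [hθ, div_le_one (by positivity)]
    have : (0 : ℝ) ≤ k := Nat.cast_nonneg k
    linarith
  refine ⟨A1 ∩ closedBall 0 ((N : ℝ) + 1), fun x hx => hA0s hx.1.1,
    hA1m.inter measurableSet_closedBall, hN, ⟨(N : ℝ) + 1, by positivity, Set.inter_subset_right⟩,
    ⟨k * ENNReal.ofReal (3 ^ s) + μH[s] A * ENNReal.ofReal ((3 / θ) ^ s) + 1, by simp, ?_, ?_⟩,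
    ⟨ENNReal.ofReal ((θ / 4) ^ s) / (k + 1), ?_, ENNReal.div_ne_top ENNReal.ofReal_ne_top (by simp), ?_⟩⟩
  · refine ENNReal.add_ne_top.mpr ⟨ENNReal.add_ne_top.mpr ⟨?_, ?_⟩, ENNReal.one_ne_top⟩
    · exact ENNReal.mul_ne_top (ENNReal.natCast_ne_top k) ENNReal.ofReal_ne_top
    · exact ENNReal.mul_ne_top hA.ne ENNReal.ofReal_ne_top
  · intro z r hr
    rcases lt_or_ge r (θ / 3) with hlt | hge
    · rcases (A1 ∩ closedBall 0 ((N : ℝ) + 1) ∩ closedBall z r).eq_empty_or_nonempty with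
        h | ⟨x, hx, hxz⟩
      · rw [h]; simp
      · obtain ⟨y, hy, hxy⟩ := Metric.mem_closure_iff.mp hx.1.2 r hr
        have h1 := (hy.2 (3 * r) (by linarith) (by linarith)).2
        calc μH[s] (A1 ∩ closedBall 0 ((N : ℝ) + 1) ∩ closedBall z r)
            ≤ μH[s] (A ∩ closedBall y (3 * r)) := by
              refine measure_mono fun w hw => ⟨hA0s hw.1.1.1, ?_⟩
              have e1 := mem_closedBall.mp hw.2
              have e2 := mem_closedBall'.mp hxz
              rw [mem_closedBall]
              linarith [dist_triangle4 w z x y]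
          _ ≤ k * ENNReal.ofReal ((3 * r) ^ s) := h1
          _ = (k * ENNReal.ofReal (3 ^ s)) * ENNReal.ofReal (r ^ s) := by
              rw [Real.mul_rpow (by norm_num) hr.le, ENNReal.ofReal_mul (by positivity), mul_assoc]
          _ ≤ _ := by
              gcongr
              rw [add_assoc]
              exact le_self_add
    · calc μH[s] (A1 ∩ closedBall 0 ((N : ℝ) + 1) ∩ closedBall z r) ≤ μH[s] A :=
            measure_mono fun w hw => hA0s hw.1.1.1
        _ = μH[s] A * 1 := by rw [mul_one]
        _ ≤ μH[s] A * (ENNReal.ofReal ((3 / θ) ^ s) * ENNReal.ofReal (r ^ s)) := by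
            gcongr
            rw [← ENNReal.ofReal_mul (by positivity), ← Real.mul_rpow (by positivity) hr.le,
              ENNReal.one_le_ofReal]
            apply Real.one_le_rpow _ hs.le
            rw [div_mul_eq_mul_div, le_div_iff₀ hθ0]
            linarith
        _ = (μH[s] A * ENNReal.ofReal ((3 / θ) ^ s)) * ENNReal.ofReal (r ^ s) := by ring
        _ ≤ _ := by
            gcongr
            refine le_trans ?_ le_self_add
            exact le_add_self
  · refine ENNReal.div_ne_zero.mpr ⟨?_, by simp⟩
    simp only [ne_eq, ENNReal.ofReal_eq_zero, not_le]
    positivity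
  · intro x hx r hr hr1
    have hr2 : 0 < r * θ / 4 := by positivity
    have hrθ : r * θ ≤ θ := by nlinarith
    have hrθ2 : r * θ ≤ r := by nlinarith
    obtain ⟨y, hy, hxy⟩ := Metric.mem_closure_iff.mp hx.1.2 (r * θ / 4) hr2
    have h1 := (hy.2 (r * θ / 4) hr2 (by linarith)).1
    have e1 : ENNReal.ofReal ((θ / 4) ^ s) / (k + 1) * ENNReal.ofReal (r ^ s) =
        ENNReal.ofReal ((r * θ / 4) ^ s) / (k + 1) := by
      rw [mul_div_assoc, Real.mul_rpow hr.le (by positivity), ENNReal.ofReal_mul (by positivity)]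
      simp only [div_eq_mul_inv]
      ring
    rw [e1]
    refine ENNReal.div_le_of_le_mul ?_
    rw [mul_comm (μH[s] _)]
    refine h1.trans ?_
    gcongr ?_ * ?_
    · exact le_self_add
    · refine measure_mono fun w hw => ⟨hw.1, ?_⟩
      have e2 := mem_closedBall.mp hw.2
      rw [mem_closedBall]
      have e3 := dist_comm x y
      linarith [dist_triangle w y x]

lemma densD_ae_eq {m : ℕ} (ν : Measure (EuclideanSpace ℝ (Fin m))) [IsFiniteMeasure ν] :
    ∀ᵐ u, densD ν u = ν.rnDeriv volume u := by
  filter_upwards [Besicovitch.ae_tendsto_rnDeriv ν volume] with u hu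
  refine Tendsto.limUnder_eq (hu.congr' ?_)
  filter_upwards [self_mem_nhdsWithin] with δ hδ
  have hδ' : (0 : ℝ) < δ := hδ
  rw [Measure.addHaar_closedBall volume u hδ'.le, finrank_euclideanSpace_fin, mul_comm,
    Measure.addHaar_closedBall volume 0 zero_le_one]
  simp

lemma lintegral_affine {m : ℕ} {R : ℝ} (hR : 0 < R) (p : EuclideanSpace ℝ (Fin m))
    (h : EuclideanSpace ℝ (Fin m) → ℝ≥0∞) (hh : Measurable h) :
    ∫⁻ v, h v = ENNReal.ofReal (R ^ m) * ∫⁻ u, h (R • u + p) := by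
  have hRm : 0 < R ^ m := by positivity
  have h1 : ∫⁻ u, h (R • u + p) = ENNReal.ofReal (R ^ m)⁻¹ * ∫⁻ v, h (v + p) := by
    have hm1 : Measurable fun u : EuclideanSpace ℝ (Fin m) => R • u := measurable_const_smul R
    have hm2 : Measurable fun v : EuclideanSpace ℝ (Fin m) => h (v + p) :=
      hh.comp (measurable_add_const p)
    rw [← lintegral_map (f := fun v => h (v + p)) hm2 hm1,
      Measure.map_addHaar_smul volume hR.ne', lintegral_smul_measure, finrank_euclideanSpace_fin,
      abs_of_pos (by positivity), smul_eq_mul]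
  rw [h1, lintegral_add_right_eq_self h p, ← mul_assoc, ← ENNReal.ofReal_mul hRm.le,
    mul_inv_cancel₀ hRm.ne']
  simp

lemma densD_scale {m : ℕ} {R : ℝ} (hR : 0 < R) (p : EuclideanSpace ℝ (Fin m))
    (ν : Measure (EuclideanSpace ℝ (Fin m))) [IsFiniteMeasure ν]
    (f : EuclideanSpace ℝ (Fin m) → ℝ≥0∞) (hf : Measurable f) (hν : ν = volume.withDensity f)
    (c : ℝ≥0∞) (hc : c ≠ ∞) :
    ∫⁻ u, densD (c • ν.map (fun v => R⁻¹ • (v - p))) u ^ 2 =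
      c ^ 2 * ENNReal.ofReal (R ^ m) * ∫⁻ v, f v ^ 2 := by
  have hSm : Measurable fun v : EuclideanSpace ℝ (Fin m) => R⁻¹ • (v - p) := by fun_prop
  have hTm : Measurable fun u : EuclideanSpace ℝ (Fin m) => R • u + p := by fun_prop
  have hfT : Measurable fun u : EuclideanSpace ℝ (Fin m) => f (R • u + p) := hf.comp hTm
  have hST : ∀ u : EuclideanSpace ℝ (Fin m), R⁻¹ • ((R • u + p) - p) = u := by
    intro u
    rw [add_sub_cancel_right, smul_smul, inv_mul_cancel₀ hR.ne', one_smul]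
  set ν' := c • ν.map (fun v => R⁻¹ • (v - p)) with hν'
  set f' : EuclideanSpace ℝ (Fin m) → ℝ≥0∞ := fun u => c * ENNReal.ofReal (R ^ m) * f (R • u + p)
    with hf'
  have hf'm : Measurable f' := (hf.comp hTm).const_mul _
  have : IsFiniteMeasure ν' := by
    rw [hν']
    exact Measure.smul_finite _ hc
  have hd : ν' = volume.withDensity f' := by
    ext E hE
    rw [hν', Measure.smul_apply, Measure.map_apply hSm hE, hν, withDensity_apply _ (hSm hE),
      withDensity_apply _ hE, ← lintegral_indicator (hSm hE),
      lintegral_affine hR p _ (hf.indicator (hSm hE))]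
    simp only [hf']
    rw [lintegral_const_mul _ hfT,
      ← lintegral_indicator hE, smul_eq_mul, mul_assoc]
    congr 2
    refine lintegral_congr fun u => ?_
    have hmem : R • u + p ∈ (fun v => R⁻¹ • (v - p)) ⁻¹' E ↔ u ∈ E := by
      rw [Set.mem_preimage, hST]
    by_cases hu : u ∈ E
    · rw [Set.indicator_of_mem hu, Set.indicator_of_mem (hmem.mpr hu)]
    · rw [Set.indicator_of_notMem hu, Set.indicator_of_notMem (fun h => hu (hmem.mp h))]
  have hae : ∀ᵐ u, densD ν' u = f' u := by
    have h1 := densD_ae_eq ν'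
    have h2 : ν'.rnDeriv volume =ᵐ[volume] f' := by
      rw [hd]; exact Measure.rnDeriv_withDensity _ hf'm
    filter_upwards [h1, h2] with u e1 e2
    rw [e1, e2]
  rw [lintegral_congr_ae (g := fun u => f' u ^ 2) (hae.mono fun u hu => by simp only [hu]),
    lintegral_affine hR p (fun v => f v ^ 2) (hf.pow_const 2), hf']
  simp only [mul_pow]
  rw [lintegral_const_mul _ (hfT.pow_const 2)]
  ring

/-- Count of cubes meeting the set. -/
lemma cube_count {n : ℕ} {s : ℝ} (A A' : Set (EuclideanSpace ℝ (Fin n)))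
    (c : ℝ≥0∞) 
    (hc : ∀ x ∈ A', ∀ r : ℝ, 0 < r → r ≤ 1 →
        c * ENNReal.ofReal (r ^ s) ≤ μH[s] (A ∩ closedBall x r)) (j : ℕ) :
    ∑' k : Fin n → ℤ, {k : Fin n → ℤ | (A' ∩ cubeIdx j ⁻¹' {k}).Nonempty}.indicator
      (fun _ => c * ENNReal.ofReal (((2 : ℝ)⁻¹ ^ j) ^ s)) k ≤ 3 ^ n * μH[s] A := by
  set W := {k : Fin n → ℤ | (A' ∩ cubeIdx j ⁻¹' {k}).Nonempty} with hW
  set ν := μH[s].restrict A with hν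
  have hρ0 : (0 : ℝ) < (2 : ℝ)⁻¹ ^ j := by positivity
  have hρ1 : (2 : ℝ)⁻¹ ^ j ≤ 1 := pow_le_one₀ (by norm_num) (by norm_num)
  set U : (Fin n → ℤ) → Set (EuclideanSpace ℝ (Fin n)) := fun k =>
    ⋃ e ∈ nbrs n, cubeIdx j ⁻¹' {k + e} with hU
  have h1 : ∀ k, W.indicator (fun _ => c * ENNReal.ofReal (((2 : ℝ)⁻¹ ^ j) ^ s)) k ≤
      ∑ e ∈ nbrs n, ν (cubeIdx j ⁻¹' {k + e}) := by
    intro k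
    by_cases hk : k ∈ W
    · rw [Set.indicator_of_mem hk]
      obtain ⟨x, hxA, hxk⟩ := hk
      have hxk' : cubeIdx j x = k := hxk
      refine (hc x hxA _ hρ0 hρ1).trans ?_
      rw [Set.inter_comm, ← Measure.restrict_apply measurableSet_closedBall]
      refine (measure_mono ?_).trans (measure_biUnion_finset_le _ _)
      intro y hy
      simp only [Set.mem_iUnion]
      refine ⟨_, cubeIdx_sub_mem j x y (mem_closedBall'.mp hy), ?_⟩
      simp [hxk']
    · rw [Set.indicator_of_notMem hk]
      exact zero_le
  have h2 : ∀ e : Fin n → ℤ, ∑' k : Fin n → ℤ, ν (cubeIdx j ⁻¹' {k + e}) ≤ μH[s] A := by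
    intro e
    rw [← measure_iUnion]
    · exact (measure_mono (Set.subset_univ _)).trans (by simp [hν])
    · intro a b hab
      refine Disjoint.preimage _ ?_
      simpa using hab
    · exact fun k => measurable_cubeIdx j (measurableSet_singleton _)
  calc _ ≤ ∑' k : Fin n → ℤ, ∑ e ∈ nbrs n, ν (cubeIdx j ⁻¹' {k + e}) := ENNReal.tsum_le_tsum h1
    _ = ∑ e ∈ nbrs n, ∑' k : Fin n → ℤ, ν (cubeIdx j ⁻¹' {k + e}) :=
        Summable.tsum_finsetSum fun _ _ => ENNReal.summable
    _ ≤ ∑ e ∈ nbrs n, μH[s] A := Finset.sum_le_sum fun e _ => h2 e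
    _ = _ := by rw [Finset.sum_const, card_nbrs, nsmul_eq_mul]; push_cast; rfl

lemma IsOrthoProj.measurable {n m : ℕ}
    (P : EuclideanSpace ℝ (Fin n) →ₗ[ℝ] EuclideanSpace ℝ (Fin m)) : Measurable P :=
  (LinearMap.continuous_of_finiteDimensional P).measurable

lemma piece_bound {n m : ℕ} {s : ℝ}
    {Λ : Type*} [MeasurableSpace Λ] (ω : Measure Λ)
    (P : Λ → (EuclideanSpace ℝ (Fin n) →ₗ[ℝ] EuclideanSpace ℝ (Fin m)))
    (C : ℝ)
    (hmain : ∀ μ : Measure (EuclideanSpace ℝ (Fin n)), IsFiniteMeasure μ → μ ≠ 0 →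
      (∃ K, IsCompact K ∧ K ⊆ closedBall 0 1 ∧ μ Kᶜ = 0) →
      (∀ x r, 0 < r → μ (closedBall x r) ≤ ENNReal.ofReal (r ^ s)) →
      (∀ᵐ l ∂ω, μ.map (P l) ≪ volume) ∧
        ∫⁻ l, ∫⁻ u, densD (μ.map (P l)) u ^ 2 ∂volume ∂ω < ENNReal.ofReal C)
    (μ : Measure (EuclideanSpace ℝ (Fin n))) [IsFiniteMeasure μ]
    (hμ : ∀ x r, 0 < r → μ (closedBall x r) ≤ ENNReal.ofReal (r ^ s))
    (Q : Set (EuclideanSpace ℝ (Fin n))) (hQ0 : μ.restrict Q ≠ 0)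
    (x0 : EuclideanSpace ℝ (Fin n)) (R : ℝ) (hR : 0 < R) (hQR : Q ⊆ closedBall x0 R) :
    (∀ᵐ l ∂ω, (μ.restrict Q).map (P l) ≪ volume) ∧
    ∀ g : Λ → EuclideanSpace ℝ (Fin m) → ℝ≥0∞, (∀ l, Measurable (g l)) →
      (∀ᵐ l ∂ω, (μ.restrict Q).map (P l) = volume.withDensity (g l)) →
      ∫⁻ l, ∫⁻ u, g l u ^ 2 ∂volume ∂ω ≤ ENNReal.ofReal C * ENNReal.ofReal (R ^ (2 * s - m)) := by
  set T : EuclideanSpace ℝ (Fin n) → EuclideanSpace ℝ (Fin n) := fun y => R⁻¹ • (y - x0) with hT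
  have hTm : Measurable T := by rw [hT]; fun_prop
  set c : ℝ≥0∞ := ENNReal.ofReal (R ^ (-s)) with hc
  have hct : c ≠ ∞ := ENNReal.ofReal_ne_top
  have hc0 : c ≠ 0 := by
    rw [hc, ne_eq, ENNReal.ofReal_eq_zero, not_le]; positivity
  set μ' : Measure (EuclideanSpace ℝ (Fin n)) := c • (μ.restrict Q).map T with hμ'
  have hPm : ∀ l, Measurable (P l) := fun l => IsOrthoProj.measurable (P l)
  have hfin : IsFiniteMeasure μ' := by
    rw [hμ']
    exact Measure.smul_finite _ hct
  have hne : μ' ≠ 0 := by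
    intro h0
    apply hQ0
    rw [← Measure.measure_univ_eq_zero]
    have h1 : μ' Set.univ = 0 := by rw [h0]; simp
    rw [hμ', Measure.smul_apply, Measure.map_apply hTm MeasurableSet.univ, smul_eq_mul] at h1
    rcases mul_eq_zero.mp h1 with h | h
    · exact absurd h hc0
    · simpa using h
  have hTball : ∀ x r, T ⁻¹' (closedBall x r) = closedBall (R • x + x0) (R * r) := by
    intro x r
    ext y
    simp only [Set.mem_preimage, mem_closedBall, hT, dist_eq_norm]
    have : y - (R • x + x0) = R • (R⁻¹ • (y - x0) - x) := by
      rw [smul_sub, smul_smul, mul_inv_cancel₀ hR.ne', one_smul]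
      abel
    rw [this, norm_smul, Real.norm_of_nonneg hR.le]
    exact (mul_le_mul_iff_right₀ hR).symm
  have hsupp : ∃ K, IsCompact K ∧ K ⊆ closedBall (0 : EuclideanSpace ℝ (Fin n)) 1 ∧ μ' Kᶜ = 0 := by
    refine ⟨closedBall 0 1, isCompact_closedBall _ _, subset_rfl, ?_⟩
    rw [hμ', Measure.smul_apply, Measure.map_apply hTm measurableSet_closedBall.compl,
      Set.preimage_compl, hTball, smul_eq_mul,
      Measure.restrict_apply measurableSet_closedBall.compl]
    have : (closedBall (R • (0 : EuclideanSpace ℝ (Fin n)) + x0) (R * 1))ᶜ ∩ Q = ∅ := by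
      rw [smul_zero, zero_add, mul_one]
      ext y
      simp only [Set.mem_inter_iff, Set.mem_compl_iff, Set.mem_empty_iff_false, iff_false]
      exact fun h => h.1 (hQR h.2)
    rw [this]; simp
  have hballs : ∀ x r, 0 < r → μ' (closedBall x r) ≤ ENNReal.ofReal (r ^ s) := by
    intro x r hr
    rw [hμ', Measure.smul_apply, Measure.map_apply hTm measurableSet_closedBall, hTball, smul_eq_mul]
    calc c * (μ.restrict Q) (closedBall (R • x + x0) (R * r))
        ≤ c * ENNReal.ofReal ((R * r) ^ s) := by
          gcongr
          exact (Measure.restrict_apply_le _ _).trans (hμ _ _ (by positivity))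
      _ = ENNReal.ofReal (r ^ s) := by
          rw [hc, ← ENNReal.ofReal_mul (by positivity), Real.mul_rpow hR.le hr.le, ← mul_assoc,
            ← Real.rpow_add hR]
          simp
  obtain ⟨hac, hintg⟩ := hmain μ' hfin hne hsupp hballs
  have hmap : ∀ l, μ'.map (P l) =
      c • ((μ.restrict Q).map (P l)).map (fun v => R⁻¹ • (v - P l x0)) := by
    intro l
    rw [hμ', Measure.map_smul, Measure.map_map (hPm l) hTm, Measure.map_map (by fun_prop) (hPm l)]
    congr 2
    funext y
    simp [hT]
  refine ⟨?_, fun g hg hgd => ?_⟩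
  · filter_upwards [hac] with l hl
    rw [hmap l] at hl
    refine Measure.AbsolutelyContinuous.mk fun E hE hE0 => ?_
    have hAm : Measurable fun u : EuclideanSpace ℝ (Fin m) => R • u + P l x0 := by fun_prop
    have hSm : Measurable fun v : EuclideanSpace ℝ (Fin m) => R⁻¹ • (v - P l x0) := by fun_prop
    have h1 : volume ((fun u : EuclideanSpace ℝ (Fin m) => R • u + P l x0) ⁻¹' E) = 0 := by
      have := lintegral_affine hR (P l x0) (E.indicator 1) (measurable_one.indicator hE)
      rw [lintegral_indicator_one hE, hE0] at this
      have h2 := (mul_eq_zero.mp this.symm).resolve_left (by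
        rw [ENNReal.ofReal_eq_zero, not_le]; positivity)
      rw [← lintegral_indicator_one (hAm hE)]
      exact h2
    have h2 := hl h1
    rw [Measure.smul_apply, Measure.map_apply hSm (hAm hE), smul_eq_mul] at h2
    have h3 := (mul_eq_zero.mp h2).resolve_left hc0
    convert h3 using 2
    ext v
    simp only [Set.mem_preimage]
    rw [smul_smul, mul_inv_cancel₀ hR.ne', one_smul, sub_add_cancel]
  · have h1 : ∀ᵐ l ∂ω, ∫⁻ u, densD (μ'.map (P l)) u ^ 2 ∂volume =
        c ^ 2 * ENNReal.ofReal (R ^ m) * ∫⁻ u, g l u ^ 2 := by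
      filter_upwards [hgd] with l hl
      rw [hmap l]
      exact densD_scale hR _ _ (g l) (hg l) hl c hct
    rw [lintegral_congr_ae h1, lintegral_const_mul' _ _
      (ENNReal.mul_ne_top (ENNReal.pow_ne_top hct) ENNReal.ofReal_ne_top)] at hintg
    have h2 : c ^ 2 * ENNReal.ofReal (R ^ m) * ENNReal.ofReal (R ^ (2 * s - m)) = 1 := by
      rw [hc, ← ENNReal.ofReal_pow (by positivity), ← ENNReal.ofReal_mul (by positivity),
        ← ENNReal.ofReal_mul (by positivity), ← Real.rpow_natCast R m, ← Real.rpow_natCast _ 2,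
        ← Real.rpow_mul hR.le, ← Real.rpow_add hR, ← Real.rpow_add hR]
      have : -s * ((2 : ℕ) : ℝ) + m + (2 * s - m) = 0 := by push_cast; ring
      rw [this]; simp
    calc ∫⁻ l, ∫⁻ u, g l u ^ 2 ∂volume ∂ω
        = (c ^ 2 * ENNReal.ofReal (R ^ m) * ENNReal.ofReal (R ^ (2 * s - m))) *
          ∫⁻ l, ∫⁻ u, g l u ^ 2 ∂volume ∂ω := by rw [h2, one_mul]
      _ = (c ^ 2 * ENNReal.ofReal (R ^ m) * ∫⁻ l, ∫⁻ u, g l u ^ 2 ∂volume ∂ω) *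
          ENNReal.ofReal (R ^ (2 * s - m)) := by ring
      _ ≤ _ := by gcongr

lemma measurable_proj {n m : ℕ} {Λ : Type*} [MetricSpace Λ] [CompactSpace Λ] [MeasurableSpace Λ]
    [BorelSpace Λ] (P : Λ → (EuclideanSpace ℝ (Fin n) →ₗ[ℝ] EuclideanSpace ℝ (Fin m)))
    (hPcont : ∀ x, Continuous fun l => P l x) :
    Measurable fun p : Λ × EuclideanSpace ℝ (Fin n) => P p.1 p.2 := by
  have h : (fun p : Λ × EuclideanSpace ℝ (Fin n) => P p.1 p.2) =
      fun p => ∑ i, p.2 i • P p.1 (EuclideanSpace.basisFun (Fin n) ℝ i) := by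
    funext p
    conv_lhs => rw [← (EuclideanSpace.basisFun (Fin n) ℝ).sum_repr p.2]
    simp
  rw [h]
  have : Continuous fun p : Λ × EuclideanSpace ℝ (Fin n) =>
      ∑ i, p.2 i • P p.1 (EuclideanSpace.basisFun (Fin n) ℝ i) := by
    refine continuous_finsetSum _ fun i _ => ?_
    have h1 : Continuous fun p : Λ × EuclideanSpace ℝ (Fin n) => p.2 i := by fun_prop
    exact h1.smul ((hPcont _).comp continuous_fst)
  exact this.measurable

/-- The kernel `l ↦ P_l♯μ`. -/
def projKernel {n m : ℕ} {Λ : Type*} [MeasurableSpace Λ]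
    (P : Λ → (EuclideanSpace ℝ (Fin n) →ₗ[ℝ] EuclideanSpace ℝ (Fin m)))
    (hP : Measurable fun p : Λ × EuclideanSpace ℝ (Fin n) => P p.1 p.2)
    (μ : Measure (EuclideanSpace ℝ (Fin n))) [IsFiniteMeasure μ] :
    ProbabilityTheory.Kernel Λ (EuclideanSpace ℝ (Fin m)) where
  toFun l := μ.map (P l)
  measurable' := by
    refine Measure.measurable_of_measurable_coe _ fun E hE => ?_
    have : (fun l => (μ.map (P l)) E) = fun l => μ (Prod.mk l ⁻¹'
        ((fun p : Λ × EuclideanSpace ℝ (Fin n) => P p.1 p.2) ⁻¹' E)) := by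
      funext l
      rw [Measure.map_apply (IsOrthoProj.measurable (P l)) hE]
      rfl
    rw [this]
    exact measurable_measure_prodMk_left (hP hE)

instance {n m : ℕ} {Λ : Type*} [MeasurableSpace Λ]
    (P : Λ → (EuclideanSpace ℝ (Fin n) →ₗ[ℝ] EuclideanSpace ℝ (Fin m)))
    (hP : Measurable fun p : Λ × EuclideanSpace ℝ (Fin n) => P p.1 p.2)
    (μ : Measure (EuclideanSpace ℝ (Fin n))) [IsFiniteMeasure μ] :
    ProbabilityTheory.IsFiniteKernel (projKernel P hP μ) :=
  ⟨⟨μ Set.univ, measure_lt_top _ _, fun l => by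
    change (μ.map (P l)) Set.univ ≤ _
    rw [Measure.map_apply (IsOrthoProj.measurable (P l)) MeasurableSet.univ]
    simp⟩⟩

lemma lower_dim {n m : ℕ} (hmn : m < n) {s : ℝ}
    {Λ : Type*} [MetricSpace Λ] [CompactSpace Λ] [MeasurableSpace Λ] [BorelSpace Λ]
    (ω : Measure Λ)
    (P : Λ → (EuclideanSpace ℝ (Fin n) →ₗ[ℝ] EuclideanSpace ℝ (Fin m)))
    (hP : ∀ l, IsOrthoProj (P l))
    (hPcont : ∀ x, Continuous fun l => P l x)
    (C : ℝ)
    (hmain : ∀ μ : Measure (EuclideanSpace ℝ (Fin n)), IsFiniteMeasure μ → μ ≠ 0 →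
      (∃ K, IsCompact K ∧ K ⊆ closedBall 0 1 ∧ μ Kᶜ = 0) →
      (∀ x r, 0 < r → μ (closedBall x r) ≤ ENNReal.ofReal (r ^ s)) →
      (∀ᵐ l ∂ω, μ.map (P l) ≪ volume) ∧
        ∫⁻ l, ∫⁻ u, densD (μ.map (P l)) u ^ 2 ∂volume ∂ω < ENNReal.ofReal C)
    (μ : Measure (EuclideanSpace ℝ (Fin n))) [IsFiniteMeasure μ] (hμ0 : μ ≠ 0)
    (hμ : ∀ x r, 0 < r → μ (closedBall x r) ≤ ENNReal.ofReal (r ^ s))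
    (A A' : Set (EuclideanSpace ℝ (Fin n))) (hA' : MeasurableSet A') (hμA' : μ A'ᶜ = 0)
    (hA : μH[s] A < ∞) (N : ℝ) (hN : 0 < N) (hA'N : A' ⊆ closedBall 0 N)
    (c : ℝ≥0∞) (hc0 : c ≠ 0) (hct : c ≠ ∞)
    (hc : ∀ x ∈ A', ∀ r : ℝ, 0 < r → r ≤ 1 →
        c * ENNReal.ofReal (r ^ s) ≤ μH[s] (A ∩ closedBall x r)) :
    (∀ᵐ l ∂ω, μ.map (P l) ≪ volume) ∧
    ∀ t : ℝ≥0, 0 < t → (t : ℝ) < s - m →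
      ∀ᵐ l ∂ω, ∀ᵐ u ∂(μ.map (P l)), (t : ℝ≥0∞) ≤ dimH ((fun y => P l y) ⁻¹' {u} ∩ A') := by
  have hPmeas := measurable_proj P hPcont
  have hPm : ∀ l, Measurable (P l) := fun l => IsOrthoProj.measurable (P l)
  have hn : (1 : ℝ) ≤ n := by exact_mod_cast (by omega : 1 ≤ n)
  have hn0 : (0 : ℝ) < n := by linarith
  have hμN : μ.restrict (closedBall 0 N) = μ := by
    refine Measure.restrict_eq_self_of_ae_mem ?_
    have h : ∀ᵐ x ∂μ, x ∈ A' := mem_ae_iff.mpr hμA'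
    filter_upwards [h] with x hx using hA'N hx
  have hac : ∀ᵐ l ∂ω, μ.map (P l) ≪ volume := by
    have := (piece_bound ω P C hmain μ hμ (closedBall 0 N) (by rwa [hμN]) 0 N hN subset_rfl).1
    rwa [hμN] at this
  refine ⟨hac, fun t ht hts => ?_⟩
  set Bm : Set (EuclideanSpace ℝ (Fin m)) := closedBall 0 N with hBm
  have hBmm : MeasurableSet Bm := measurableSet_closedBall
  set v : Measure (EuclideanSpace ℝ (Fin m)) := volume.restrict Bm with hv
  have hvfin : IsFiniteMeasure v := ⟨by
    rw [hv, Measure.restrict_apply_univ]; exact measure_closedBall_lt_top⟩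
  have hacv : ∀ᵐ l ∂ω, μ.map (P l) ≪ v := by
    filter_upwards [hac] with l hl
    refine Measure.AbsolutelyContinuous.mk fun E hE hE0 => ?_
    rw [hv, Measure.restrict_apply hE] at hE0
    have h1 : μ.map (P l) Bmᶜ = 0 := by
      rw [Measure.map_apply (hPm l) hBmm.compl]
      refine measure_mono_null ?_ hμA'
      intro x hx hxA
      apply hx
      have h2 := mem_closedBall_zero_iff.mp (hA'N hxA)
      exact mem_closedBall_zero_iff.mpr (((hP l).norm_le x).trans h2)
    have hsub : E ⊆ (E ∩ Bm) ∪ Bmᶜ := by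
      intro u hu
      by_cases h : u ∈ Bm
      · exact Or.inl ⟨hu, h⟩
      · exact Or.inr h
    exact measure_mono_null hsub (measure_union_null (hl hE0) h1)
  have hQm : ∀ j (k : Fin n → ℤ), MeasurableSet
      (cubeIdx j ⁻¹' {k} : Set (EuclideanSpace ℝ (Fin n))) :=
    fun j k => measurable_cubeIdx j (measurableSet_singleton k)
  set κ : ℕ → (Fin n → ℤ) → ProbabilityTheory.Kernel Λ (EuclideanSpace ℝ (Fin m)) := fun j k =>
    projKernel P hPmeas (μ.restrict (cubeIdx j ⁻¹' {k})) with hκ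
  have hκfin : ∀ j k, ProbabilityTheory.IsFiniteKernel (κ j k) := fun j k => by
    rw [hκ]; infer_instance
  set η : ProbabilityTheory.Kernel Λ (EuclideanSpace ℝ (Fin m)) :=
    ProbabilityTheory.Kernel.const Λ v with hη
  set g : ℕ → (Fin n → ℤ) → Λ → EuclideanSpace ℝ (Fin m) → ℝ≥0∞ := fun j k l u =>
    (κ j k).rnDeriv η l u with hg
  have hgm2 : ∀ j k, Measurable fun p : Λ × EuclideanSpace ℝ (Fin m) => g j k p.1 p.2 :=
    fun j k => ProbabilityTheory.Kernel.measurable_rnDeriv (κ j k) η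
  have hgm : ∀ j k l, Measurable (g j k l) := fun j k l =>
    (hgm2 j k).comp (measurable_const.prodMk measurable_id)
  have hgd : ∀ᵐ l ∂ω, ∀ j k, (μ.restrict (cubeIdx j ⁻¹' {k})).map (P l) =
      v.withDensity (g j k l) := by
    filter_upwards [hacv] with l hl j k
    have h1 : (κ j k) l ≪ η l := by
      change (μ.restrict (cubeIdx j ⁻¹' {k})).map (P l) ≪ v
      exact (Measure.absolutelyContinuous_of_le
        (Measure.map_mono Measure.restrict_le_self (hPm l))).trans hl
    have h2 := ProbabilityTheory.Kernel.withDensity_rnDeriv_eq h1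
    rw [ProbabilityTheory.Kernel.withDensity_apply _
      (ProbabilityTheory.Kernel.measurable_rnDeriv (κ j k) η)] at h2
    exact h2.symm
  set I : ℕ → (Fin n → ℤ) → Λ → ℝ≥0∞ := fun j k l => ∫⁻ u, g j k l u ^ 2 ∂v with hI
  have hIm : ∀ j k, Measurable (I j k) := fun j k =>
    Measurable.lintegral_prod_right' ((hgm2 j k).pow_const 2)
  set W : ℕ → Set (Fin n → ℤ) := fun j => {k | (A' ∩ cubeIdx j ⁻¹' {k}).Nonempty} with hW
  set R : ℕ → ℝ := fun j => n * (2 : ℝ)⁻¹ ^ j with hR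
  have hR0 : ∀ j, 0 < R j := fun j => by rw [hR]; positivity
  have hIb : ∀ j k, ∫⁻ l, I j k l ∂ω ≤ (W j).indicator
      (fun _ => ENNReal.ofReal C * ENNReal.ofReal (R j ^ (2 * s - m))) k := by
    intro j k
    by_cases h0 : μ.restrict (cubeIdx j ⁻¹' {k}) = 0
    · have : ∫⁻ l, I j k l ∂ω = 0 := by
        rw [lintegral_eq_zero_iff (hIm j k)]
        filter_upwards [hgd] with l hl
        have h1 := hl j k
        rw [h0, Measure.map_zero] at h1
        have h2 := (withDensity_eq_zero_iff (hgm j k l).aemeasurable).mp h1.symm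
        change ∫⁻ u, g j k l u ^ 2 ∂v = 0
        rw [lintegral_eq_zero_iff ((hgm j k l).pow_const 2)]
        filter_upwards [h2] with u hu
        simp [hu]
      rw [this]; exact zero_le
    · have hne : (A' ∩ cubeIdx j ⁻¹' {k}).Nonempty := by
        by_contra hemp
        rw [Set.not_nonempty_iff_eq_empty] at hemp
        apply h0
        rw [Measure.restrict_eq_zero]
        refine measure_mono_null ?_ hμA'
        intro x hx hxA
        have : x ∈ A' ∩ cubeIdx j ⁻¹' {k} := ⟨hxA, hx⟩
        rw [hemp] at this
        exact this
      have hk : k ∈ W j := hne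
      rw [Set.indicator_of_mem hk]
      obtain ⟨x, hxA, hxk⟩ := hne
      have hxk' : cubeIdx j x = k := hxk
      have hsub : (cubeIdx j ⁻¹' {k} : Set (EuclideanSpace ℝ (Fin n))) ⊆ closedBall x (R j) := by
        intro y hy
        have hy' : cubeIdx j y = k := hy
        exact mem_closedBall.mpr (dist_le_of_cubeIdx_eq j y x (by rw [hy', hxk']))
      have hpb := (piece_bound ω P C hmain μ hμ (cubeIdx j ⁻¹' {k}) h0 x (R j) (hR0 j) hsub).2
        (fun l => Bm.indicator (g j k l)) (fun l => (hgm j k l).indicator hBmm) (by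
          filter_upwards [hgd] with l hl
          rw [hl j k, withDensity_indicator hBmm])
      refine le_trans (le_of_eq ?_) hpb
      refine lintegral_congr fun l => ?_
      rw [hI]
      simp only []
      rw [hv, ← lintegral_indicator hBmm]
      refine lintegral_congr fun u => ?_
      by_cases hu : u ∈ Bm
      · rw [Set.indicator_of_mem hu, Set.indicator_of_mem hu]
      · rw [Set.indicator_of_notMem hu, Set.indicator_of_notMem hu]; simp
  set H : ℝ≥0∞ := 3 ^ n * μH[s] A with hH
  have hHt : H ≠ ∞ := ENNReal.mul_ne_top (by simp) hA.ne
  set D : ℝ≥0∞ := ENNReal.ofReal C * ENNReal.ofReal ((n : ℝ) ^ (2 * s - m)) * (H * c⁻¹) with hD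
  have hDt : D ≠ ∞ := ENNReal.mul_ne_top (ENNReal.mul_ne_top ENNReal.ofReal_ne_top
    ENNReal.ofReal_ne_top) (ENNReal.mul_ne_top hHt (ENNReal.inv_ne_top.mpr hc0))
  have hhalf : ∀ (j : ℕ) (a : ℝ), ENNReal.ofReal (((2 : ℝ)⁻¹ ^ j) ^ a) = (2 : ℝ≥0∞) ^ (-(j * a)) := by
    intro j a
    rw [← ENNReal.ofReal_rpow_of_pos (by positivity), ENNReal.ofReal_pow (by norm_num),
      ENNReal.ofReal_inv_of_pos (by norm_num), ENNReal.ofReal_ofNat, ← ENNReal.rpow_natCast,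
      ← ENNReal.rpow_neg_one, ← ENNReal.rpow_mul, ← ENNReal.rpow_mul]
    congr 1; ring
  have hsumk : ∀ j : ℕ, ∑' k, ∫⁻ l, I j k l ∂ω ≤ D * (2 : ℝ≥0∞) ^ (-(j * (s - m))) := by
    intro j
    have hcc := cube_count A A' c hc j
    rw [← hH] at hcc
    set X : ℝ≥0∞ := (2 : ℝ≥0∞) ^ (j * s) with hX
    have e0 : c * ENNReal.ofReal (((2 : ℝ)⁻¹ ^ j) ^ s) * (c⁻¹ * X) = 1 := by
      rw [hhalf, mul_mul_mul_comm, ENNReal.mul_inv_cancel hc0 hct, hX,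
        ← ENNReal.rpow_add _ _ (by simp) (by simp)]
      simp
    set Y : ℝ≥0∞ := ENNReal.ofReal C * ENNReal.ofReal (R j ^ (2 * s - m)) with hY
    calc ∑' k, ∫⁻ l, I j k l ∂ω ≤ ∑' k, (W j).indicator (fun _ => Y) k :=
          ENNReal.tsum_le_tsum (hIb j)
      _ = ∑' k, (Y * (c⁻¹ * X)) * (W j).indicator
            (fun _ => c * ENNReal.ofReal (((2 : ℝ)⁻¹ ^ j) ^ s)) k := by
          refine tsum_congr fun k => ?_
          by_cases hk : k ∈ W j
          · rw [Set.indicator_of_mem hk, Set.indicator_of_mem hk, mul_assoc,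
              mul_comm (c⁻¹ * X), e0, mul_one]
          · rw [Set.indicator_of_notMem hk, Set.indicator_of_notMem hk, mul_zero]
      _ ≤ (Y * (c⁻¹ * X)) * H := by
          rw [ENNReal.tsum_mul_left]
          gcongr
      _ = D * (2 : ℝ≥0∞) ^ (-(j * (s - m))) := by
          have e1 : ENNReal.ofReal (R j ^ (2 * s - m)) * X =
              ENNReal.ofReal ((n : ℝ) ^ (2 * s - m)) * (2 : ℝ≥0∞) ^ (-(j * (s - m))) := by
            rw [hR]
            simp only []
            rw [Real.mul_rpow hn0.le (by positivity), ENNReal.ofReal_mul (by positivity), hhalf, hX,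
              mul_assoc, ← ENNReal.rpow_add _ _ (by simp) (by simp)]
            congr 2; ring
          calc Y * (c⁻¹ * X) * H = ENNReal.ofReal C * (ENNReal.ofReal (R j ^ (2 * s - m)) * X) *
                (H * c⁻¹) := by rw [hY]; ring
            _ = _ := by rw [e1, hD]; ring
  have hfinal : ∀ᵐ l ∂ω, ∑' j : ℕ, (2 : ℝ≥0∞) ^ (j * (t : ℝ)) * ∑' k, I j k l < ∞ := by
    have hm1 : ∀ j, Measurable fun l => ∑' k, I j k l := fun j => Measurable.tsum (hIm j)
    refine ae_lt_top (Measurable.tsum fun j => (hm1 j).const_mul _) ?_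
    rw [lintegral_tsum fun j => ((hm1 j).const_mul _).aemeasurable]
    have hb : ∀ j : ℕ, ∫⁻ l, (2 : ℝ≥0∞) ^ (j * (t : ℝ)) * ∑' k, I j k l ∂ω ≤
        D * ((2 : ℝ≥0∞) ^ ((t : ℝ) - (s - m))) ^ j := by
      intro j
      rw [lintegral_const_mul _ (hm1 j), lintegral_tsum fun k => (hIm j k).aemeasurable]
      calc _ ≤ (2 : ℝ≥0∞) ^ (j * (t : ℝ)) * (D * (2 : ℝ≥0∞) ^ (-(j * (s - m)))) := by
            gcongr; exact hsumk j
        _ = D * ((2 : ℝ≥0∞) ^ (j * (t : ℝ)) * (2 : ℝ≥0∞) ^ (-(j * (s - m)))) := by ring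
        _ = _ := by
            rw [← ENNReal.rpow_add _ _ (by simp) (by simp), ← ENNReal.rpow_natCast _ j,
              ← ENNReal.rpow_mul]
            congr 2; ring
    refine ((ENNReal.tsum_le_tsum hb).trans_lt ?_).ne
    rw [ENNReal.tsum_mul_left, ENNReal.tsum_geometric]
    refine ENNReal.mul_lt_top hDt.lt_top ?_
    rw [ENNReal.inv_lt_top, tsub_pos_iff_lt]
    exact ENNReal.rpow_lt_one_of_one_lt_of_neg (by norm_num) (by linarith)
  filter_upwards [hfinal, hgd, hacv] with l h1 h2 h3
  exact slices_dim μ (fun y => P l y) (hPm l) v h3 A' hA' hμA' t ht (fun j k => g j k l)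
    (fun j k => hgm j k l) h2 h1.ne

theorem stmt1 {n m : ℕ} (hm : 1 ≤ m) (hmn : m < n) {s : ℝ} (hs : (m : ℝ) < s)
    {Λ : Type*} [MetricSpace Λ] [CompactSpace Λ] [MeasurableSpace Λ] [BorelSpace Λ]
    (ω : Measure Λ) [IsFiniteMeasure ω] (hω : ω ≠ 0)
    (P : Λ → (EuclideanSpace ℝ (Fin n) →ₗ[ℝ] EuclideanSpace ℝ (Fin m)))
    (hP : ∀ l, IsOrthoProj (P l))
    (hPcont : ∀ x, Continuous fun l => P l x)
    (C : ℝ) (hC : 0 < C)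
    (hmain : ∀ μ : Measure (EuclideanSpace ℝ (Fin n)), IsFiniteMeasure μ → μ ≠ 0 →
      (∃ K, IsCompact K ∧ K ⊆ closedBall 0 1 ∧ μ Kᶜ = 0) →
      (∀ x r, 0 < r → μ (closedBall x r) ≤ ENNReal.ofReal (r ^ s)) →
      (∀ᵐ l ∂ω, μ.map (P l) ≪ volume) ∧
        ∫⁻ l, ∫⁻ u, densD (μ.map (P l)) u ^ 2 ∂volume ∂ω < ENNReal.ofReal C)
    (A : Set (EuclideanSpace ℝ (Fin n))) (hAm : NullMeasurableSet A μH[s])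
    (hA0 : 0 < μH[s] A) [hA1 : Fact (μH[s] A < ∞)]
    (hld : ∀ᵐ x ∂(μH[s].restrict A), 0 < lowerDensity s A x) :
    ∀ᵐ l ∂ω,
      0 < volume {u : EuclideanSpace ℝ (Fin m) |
        dimH ((fun y => P l y) ⁻¹' {u} ∩ A) = ENNReal.ofReal (s - m)} := by
  have hA : μH[s] A < ∞ := hA1.out
  have hs0 : 0 < s := lt_of_le_of_lt (Nat.cast_nonneg m) hs
  have hsm : 0 < s - m := by linarith
  obtain ⟨A', hA's, hA'm, hA'0, ⟨N, hN0, hA'N⟩, ⟨K, hK0, hKt, hK⟩, ⟨c, hc0, hct, hc⟩⟩ :=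
    exists_good_subset hs0 A hAm hA0 hA hld
  have hA't : μH[s] A' < ∞ := (measure_mono hA's).trans_lt hA
  set μ : Measure (EuclideanSpace ℝ (Fin n)) := K⁻¹ • (μH[s]).restrict A' with hμ
  have hfr : IsFiniteMeasure ((μH[s]).restrict A') := ⟨by
    rw [Measure.restrict_apply_univ]; exact hA't⟩
  have hKi : K⁻¹ ≠ ∞ := ENNReal.inv_ne_top.mpr hK0
  have hfin : IsFiniteMeasure μ := by
    rw [hμ]; exact Measure.smul_finite _ hKi
  have hμu : μ Set.univ ≠ 0 := by
    rw [hμ, Measure.smul_apply, Measure.restrict_apply_univ, smul_eq_mul]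
    exact mul_ne_zero (ENNReal.inv_ne_zero.mpr hKt) hA'0
  have hμ0 : μ ≠ 0 := by
    intro h; rw [h] at hμu; simp at hμu
  have hμA' : μ A'ᶜ = 0 := by
    rw [hμ, Measure.smul_apply, Measure.restrict_apply hA'm.compl]; simp
  have hμb : ∀ x r, 0 < r → μ (closedBall x r) ≤ ENNReal.ofReal (r ^ s) := by
    intro x r hr
    rw [hμ, Measure.smul_apply, Measure.restrict_apply measurableSet_closedBall, Set.inter_comm,
      smul_eq_mul]
    calc K⁻¹ * μH[s] (A' ∩ closedBall x r) ≤ K⁻¹ * (K * ENNReal.ofReal (r ^ s)) := by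
          gcongr; exact hK x r hr
      _ = _ := by rw [← mul_assoc, ENNReal.inv_mul_cancel hK0 hKt, one_mul]
  obtain ⟨hac, hlow⟩ := lower_dim hmn ω P hP hPcont C hmain μ hμ0 hμb A A' hA'm hμA' hA N hN0 hA'N
    c hc0 hct hc
  set d : ℝ≥0 := (s - m).toNNReal with hd
  have hd0 : 0 < d := Real.toNNReal_pos.mpr hsm
  have hdr : (d : ℝ) = s - m := Real.coe_toNNReal _ hsm.le
  obtain ⟨τ, -, hτ, hτl⟩ := exists_seq_strictMono_tendsto' hd0
  have hall : ∀ᵐ l ∂ω, ∀ i, ∀ᵐ u ∂(μ.map (P l)),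
      (τ i : ℝ≥0∞) ≤ dimH ((fun y => P l y) ⁻¹' {u} ∩ A') := by
    refine ae_all_iff.mpr fun i => hlow (τ i) (hτ i).1 ?_
    rw [← hdr]
    exact_mod_cast (hτ i).2
  filter_upwards [hac, hall] with l hl1 hl2
  have hup := slice_upper hs (fun y => P l y) (fun x y => by
    rw [edist_dist, edist_dist, dist_eq_norm, dist_eq_norm, ← map_sub]
    exact ENNReal.ofReal_le_ofReal ((hP l).norm_le _)) A hA
  set S := {u : EuclideanSpace ℝ (Fin m) |
        dimH ((fun y => P l y) ⁻¹' {u} ∩ A) = ENNReal.ofReal (s - m)} with hS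
  have hmem : ∀ᵐ u ∂(μ.map (P l)), u ∈ S := by
    filter_upwards [ae_all_iff.mpr hl2, hl1.ae_le hup] with u h1 h2
    refine le_antisymm h2 ?_
    have h3 : Tendsto (fun i => (τ i : ℝ≥0∞)) atTop (𝓝 (d : ℝ≥0∞)) := ENNReal.tendsto_coe.mpr hτl
    exact le_of_tendsto' h3 fun i => (h1 i).trans (dimH_mono (Set.inter_subset_inter_right _ hA's))
  rw [pos_iff_ne_zero]
  intro hS0
  have h4 : ∀ᵐ u ∂(μ.map (P l)), u ∉ S := measure_eq_zero_iff_ae_notMem.mp (hl1 hS0)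
  have h5 : ∀ᵐ u ∂(μ.map (P l)), False := by
    filter_upwards [hmem, h4] with u a b using b a
  have h6 : μ.map (P l) = 0 := by simpa using h5
  apply hμu
  have h7 : μ.map (P l) Set.univ = 0 := by rw [h6]; simp
  rwa [Measure.map_apply (IsOrthoProj.measurable (P l)) MeasurableSet.univ, Set.preimage_univ] at h7

end
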